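/- Let A₁, …, A_k be jointly refluent canonical command sets, let M be a merger of A₁, …, A_k, and let FS be a filesystem that none of the A_i breaks. Then for each i: M ∩ A_i is an initial segment of both A_i and M, and applying first the canonical set (A_i ∖ M)⁻¹ and then the canonical set M ∖ A_i to the filesystem A_iFS yields the filesystem MFS. -/

import Mathlib

namespace FileSync

/-- A filesystem value: a directory, the empty value, or a file with content from `C`. -/
inductive Val (C : Type) : Type where
  | dir : Val C
  | empty : Val C
  | file : C → Val C

/-- The type of a value, ordered E < F < D via 0 < 1 < 2. -/
def vtype {C : Type} : Val C → ℕ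
  | Val.empty => 0
  | Val.file _ => 1
  | Val.dir => 2

/-- A node is a nonempty finite sequence of names. -/
abbrev Node (N : Type) : Type := { l : List N // l ≠ ([] : List N) }

/-- `Anc m n`: `m` is a proper ancestor of (strictly above) `n`. -/
def Anc {N : Type} (m n : Node N) : Prop := m.1 <+: n.1 ∧ m ≠ n

/-- Two nodes are comparable if one is a prefix of the other. -/
def NodesComparable {N : Type} (m n : Node N) : Prop := m.1 <+: n.1 ∨ n.1 <+: m.1

/-- `IsParent p n`: `p` is the parent of `n` (removing the last name of `n` gives `p`). -/
def IsParent {N : Type} (p n : Node N) : Prop := ∃ a : N, n.1 = p.1 ++ [a]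

/-- A command: a node, an input value (precondition) and an output value. -/
structure Cmd (N C : Type) where
  node : Node N
  inp : Val C
  out : Val C

variable {N C : Type} [DecidableEq N]

/-- A valid filesystem: finitely many non-empty nodes, and the tree property. -/
def ValidFS (f : Node N → Val C) : Prop :=
  {n : Node N | f n ≠ Val.empty}.Finite ∧
  ∀ n m : Node N, Anc m n → f n ≠ Val.empty → f m = Val.dir

/-- Replace the value at the node of `σ` by its output value. -/
def upd (f : Node N → Val C) (σ : Cmd N C) : Node N → Val C :=
  fun m => if m = σ.node then σ.out else f m

/-- `SeqOK α f`: the command sequence `α` does not break the filesystem `f`: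
each command finds its input value and yields a valid filesystem. -/
def SeqOK : List (Cmd N C) → (Node N → Val C) → Prop
  | [], _ => True
  | σ :: rest, f => f σ.node = σ.inp ∧ ValidFS (upd f σ) ∧ SeqOK rest (upd f σ)

/-- The result of applying a command sequence (left to right). -/
def applySeq : List (Cmd N C) → (Node N → Val C) → (Node N → Val C)
  | [], f => f
  | σ :: rest, f => applySeq rest (upd f σ)

/-- A sequence is non-breaking if there is at least one filesystem it does not break. -/
def NonBreaking (α : List (Cmd N C)) : Prop := ∃ f, ValidFS f ∧ SeqOK α f

/-- Semantic equivalence: on every filesystem both break, or both yield the same result. -/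
def SeqEquiv (α β : List (Cmd N C)) : Prop :=
  ∀ f, ValidFS f → ((SeqOK α f ↔ SeqOK β f) ∧ (SeqOK α f → applySeq α f = applySeq β f))

/-- `SeqExt α β`: `β` semantically extends `α` (`α ≤ β`). -/
def SeqExt (α β : List (Cmd N C)) : Prop :=
  ∀ f, ValidFS f → SeqOK α f → SeqOK β f ∧ applySeq β f = applySeq α f

/-- The `≪` relation between commands on child–parent or parent–child nodes. -/
def LL (σ τ : Cmd N C) : Prop :=
  (IsParent τ.node σ.node ∧ σ.out = Val.empty ∧ σ.inp ≠ Val.empty ∧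
      τ.inp = Val.dir ∧ τ.out ≠ Val.dir) ∨
  (IsParent σ.node τ.node ∧ σ.out = Val.dir ∧ σ.inp ≠ Val.dir ∧
      τ.inp = Val.empty ∧ τ.out ≠ Val.empty)

/-- A canonical command set: finite, no null commands, at most one command per node,
`≪`-connected (commands on distinct comparable nodes are joined by a `≪`-chain in the set). -/
def Canonical (A : Set (Cmd N C)) : Prop :=
  A.Finite ∧
  (∀ σ ∈ A, σ.inp ≠ σ.out) ∧
  (∀ σ ∈ A, ∀ τ ∈ A, σ.node = τ.node → σ = τ) ∧
  (∀ σ ∈ A, ∀ τ ∈ A, σ.node ≠ τ.node → NodesComparable σ.node τ.node →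
    Relation.ReflTransGen (fun a b => a ∈ A ∧ b ∈ A ∧ LL a b) σ τ ∨
    Relation.ReflTransGen (fun a b => a ∈ A ∧ b ∈ A ∧ LL a b) τ σ)

/-- A sequence honors `≪`: whenever `σ ≪ τ` for members, `σ` precedes `τ`. -/
def Honors (α : List (Cmd N C)) : Prop :=
  ∀ σ ∈ α, ∀ τ ∈ α, LL σ τ → List.Sublist [σ, τ] α

/-- A canonical sequence: its commands form a canonical set and it honors `≪`. -/
def CanonicalSeq (α : List (Cmd N C)) : Prop :=
  α.Nodup ∧ Canonical {σ : Cmd N C | σ ∈ α} ∧ Honors α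

/-- `Orders A α`: the sequence `α` is an arrangement of the set `A` honoring `≪`. -/
def Orders (A : Set (Cmd N C)) (α : List (Cmd N C)) : Prop :=
  α.Nodup ∧ (∀ σ : Cmd N C, σ ∈ α ↔ σ ∈ A) ∧ Honors α

/-- The action of a canonical set: `A` does not break `f`
(some `≪`-honoring arrangement exists, and every such arrangement works on `f`). -/
def SetNoBreak (A : Set (Cmd N C)) (f : Node N → Val C) : Prop :=
  (∃ α, Orders A α) ∧ ∀ α, Orders A α → SeqOK α f

/-- `SetApp A f g`: applying the set `A` (in any `≪`-honoring order) to `f` yields `g`. -/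
def SetApp (A : Set (Cmd N C)) (f g : Node N → Val C) : Prop :=
  SetNoBreak A f ∧ ∀ α, Orders A α → applySeq α f = g

/-- The set `S` has a command on node `n`. -/
def Mentions (S : Set (Cmd N C)) (n : Node N) : Prop := ∃ ρ ∈ S, ρ.node = n

/-- Two canonical sets are refluent if some filesystem is broken by neither. -/
def Refluent (A B : Set (Cmd N C)) : Prop :=
  ∃ f, ValidFS f ∧ SetNoBreak A f ∧ SetNoBreak B f

/-- Canonical sets are jointly refluent if a single filesystem is broken by none of them. -/
def JointlyRefluent {k : ℕ} (A : Fin k → Set (Cmd N C)) : Prop :=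
  ∃ f, ValidFS f ∧ ∀ i, SetNoBreak (A i) f

/-- Two distinct commands are in conflict if they are on the same node, or one is on a
proper ancestor node, creates a non-directory, and the lower one creates non-empty content. -/
def Conflict (σ τ : Cmd N C) : Prop :=
  σ ≠ τ ∧ (σ.node = τ.node ∨
    (Anc σ.node τ.node ∧ σ.out ≠ Val.dir ∧ τ.out ≠ Val.empty) ∨
    (Anc τ.node σ.node ∧ τ.out ≠ Val.dir ∧ σ.out ≠ Val.empty))

/-- A merger: a maximal canonical subset of `⋃ i, A i`. -/
def Merger {k : ℕ} (A : Fin k → Set (Cmd N C)) (M : Set (Cmd N C)) : Prop :=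
  M ⊆ (⋃ i, A i) ∧ Canonical M ∧
  ∀ M' : Set (Cmd N C), M ⊆ M' → M' ⊆ (⋃ i, A i) → Canonical M' → M' = M

/-- `B` is an initial segment of `A`: there is an `≪`-honoring arrangement of `A` in which
all commands of `B` precede all commands of `A \ B`. -/
def InitSeg (B A : Set (Cmd N C)) : Prop :=
  B ⊆ A ∧ ∃ α₁ α₂ : List (Cmd N C), Orders B α₁ ∧ Orders (A \ B) α₂ ∧ Orders A (α₁ ++ α₂)

/-- The inverse of a command. -/
def cinv (σ : Cmd N C) : Cmd N C := ⟨σ.node, σ.out, σ.inp⟩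

/-- The inverse of a sequence: inverses of its commands in reverse order. -/
def seqInv (α : List (Cmd N C)) : List (Cmd N C) := (α.map cinv).reverse


set_option linter.unusedSectionVars false

theorem anc_of_parent {p n : Node N} (h : IsParent p n) : Anc p n := by
  obtain ⟨a, ha⟩ := h
  refine ⟨⟨[a], ha.symm⟩, ?_⟩
  rintro rfl
  have := congrArg List.length ha
  simp at this

theorem Anc.length_lt {m n : Node N} (h : Anc m n) : m.1.length < n.1.length := by
  rcases lt_or_eq_of_le h.1.length_le with h' | h'
  · exact h'
  · exact absurd (Subtype.ext (h.1.eq_of_length h')) h.2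

theorem Anc.of_pre {m n : Node N} (h : m.1 <+: n.1) (hl : m.1.length < n.1.length) :
    Anc m n := ⟨h, by rintro rfl; omega⟩

theorem Anc.trans' {a b c : Node N} (h : Anc a b) (h' : Anc b c) : Anc a c :=
  Anc.of_pre (h.1.trans h'.1) (h.length_lt.trans h'.length_lt)

theorem Anc.asymm' {a b : Node N} (h : Anc a b) (h' : Anc b a) : False := by
  have := h.length_lt
  have := h'.length_lt
  omega

theorem IsParent.length_eq {p n : Node N} (h : IsParent p n) : n.1.length = p.1.length + 1 := by
  obtain ⟨a, ha⟩ := h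
  simp [ha]

theorem anc_parent {m p n : Node N} (h : Anc m n) (hp : IsParent p n) : m = p ∨ Anc m p := by
  have h1 := h.length_lt
  have h2 := hp.length_eq
  have h3 : m.1 <+: p.1 := List.prefix_of_prefix_length_le h.1 (anc_of_parent hp).1 (by omega)
  by_cases e : m = p
  · exact Or.inl e
  · exact Or.inr ⟨h3, e⟩

/-- two ancestors of the same node are comparable -/
theorem anc_total {a b n : Node N} (h : Anc a n) (h' : Anc b n) : a = b ∨ Anc a b ∨ Anc b a := by
  by_cases e : a = b
  · exact Or.inl e
  · rcases le_total a.1.length b.1.length with hl | hl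
    · exact Or.inr (Or.inl ⟨List.prefix_of_prefix_length_le h.1 h'.1 hl, e⟩)
    · exact Or.inr (Or.inr ⟨List.prefix_of_prefix_length_le h'.1 h.1 hl, Ne.symm e⟩)

theorem exists_parent {m n : Node N} (h : Anc m n) : ∃ p, IsParent p n := by
  have hl := h.length_lt
  have hm : 0 < m.1.length := List.length_pos_iff.2 m.2
  refine ⟨⟨n.1.dropLast, ?_⟩, n.1.getLast n.2, (List.dropLast_append_getLast n.2).symm⟩
  intro h0
  have := congrArg List.length h0
  simp at this
  omega

theorem validFS_of_parent {f : Node N → Val C} (hfin : {n : Node N | f n ≠ Val.empty}.Finite)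
    (h : ∀ n m : Node N, IsParent m n → f n ≠ Val.empty → f m = Val.dir) : ValidFS f := by
  refine ⟨hfin, ?_⟩
  intro n
  induction hk : n.1.length generalizing n with
  | zero => exact absurd (List.length_eq_zero_iff.1 hk) n.2
  | succ k ih =>
    intro m hm hn
    obtain ⟨p, hp⟩ := exists_parent hm
    have hpd := h n p hp hn
    rcases anc_parent hm hp with rfl | hmp
    · exact hpd
    · exact ih p (by have := hp.length_eq; omega) m hmp (by simp [hpd])

/-- `g` is `f` overwritten by `S`. -/
def IsApp (S : Set (Cmd N C)) (f g : Node N → Val C) : Prop :=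
  (∀ σ ∈ S, g σ.node = σ.out) ∧ ∀ n, (∀ σ ∈ S, σ.node ≠ n) → g n = f n

theorem IsApp.exists_cmd {S : Set (Cmd N C)} {f g : Node N → Val C} (h : IsApp S f g)
    {n : Node N} (hn : g n ≠ f n) : ∃ σ ∈ S, σ.node = n ∧ σ.out = g n := by
  by_contra hcon
  push Not at hcon
  apply hn
  apply h.2
  rintro σ hσ rfl
  exact hcon σ hσ rfl (h.1 σ hσ).symm

theorem IsApp.unique {S : Set (Cmd N C)} {f g g' : Node N → Val C} (h : IsApp S f g)
    (h' : IsApp S f g') : g = g' := by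
  funext n
  by_cases hn : ∃ σ ∈ S, σ.node = n
  · obtain ⟨σ, hσ, rfl⟩ := hn
    rw [h.1 σ hσ, h'.1 σ hσ]
  · push Not at hn
    rw [h.2 n hn, h'.2 n hn]

/-- at most one command on each node -/
def NodeInj (S : Set (Cmd N C)) : Prop := ∀ σ ∈ S, ∀ τ ∈ S, σ.node = τ.node → σ = τ

theorem exists_isApp {S : Set (Cmd N C)} (hS : NodeInj S) (f : Node N → Val C) :
    ∃ g, IsApp S f g := by
  classical
  refine ⟨fun n => if h : ∃ σ ∈ S, σ.node = n then h.choose.out else f n, ?_, ?_⟩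
  · intro σ hσ
    have h : ∃ τ ∈ S, τ.node = σ.node := ⟨σ, hσ, rfl⟩
    simp only [dif_pos h]
    rw [hS _ h.choose_spec.1 σ hσ h.choose_spec.2]
  · intro n hn
    have h : ¬ ∃ σ ∈ S, σ.node = n := by push Not; exact hn
    simp only [dif_neg h]

theorem IsApp.finite {S : Set (Cmd N C)} {f g : Node N → Val C} (h : IsApp S f g)
    (hS : S.Finite) (hf : ValidFS f) : {n : Node N | g n ≠ Val.empty}.Finite := by
  refine (hf.1.union (hS.image Cmd.node)).subset ?_
  intro n hn
  by_cases hm : ∃ σ ∈ S, σ.node = n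
  · exact Or.inr hm
  · push Not at hm
    left
    have := h.2 n hm
    simp only [Set.mem_setOf_eq] at hn ⊢
    rwa [← this]

section seqs

theorem applySeq_isApp (α : List (Cmd N C)) (f : Node N → Val C) (hnd : α.Nodup)
    (hinj : NodeInj {σ | σ ∈ α}) : IsApp {σ | σ ∈ α} f (applySeq α f) := by
  induction α generalizing f with
  | nil => exact ⟨by simp, by simp [applySeq]⟩
  | cons σ α ih =>
    have hnd' := List.nodup_cons.1 hnd
    have hinj' : NodeInj {σ | σ ∈ α} := fun a ha b hb =>
      hinj a (List.mem_cons_of_mem _ ha) b (List.mem_cons_of_mem _ hb)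
    have := ih (upd f σ) hnd'.2 hinj'
    refine ⟨?_, ?_⟩
    · intro τ hτ
      rcases List.mem_cons.1 hτ with rfl | hτ
      · rw [applySeq, this.2 τ.node]
        · simp [upd]
        · intro ρ hρ e
          have : ρ = τ := hinj ρ (List.mem_cons_of_mem _ hρ) τ (by simp) e
          subst this
          exact hnd'.1 hρ
      · exact this.1 τ hτ
    · intro n hn
      rw [applySeq, this.2 n (fun τ hτ => hn τ (List.mem_cons_of_mem _ hτ))]
      have : n ≠ σ.node := fun e => hn σ (by simp) e.symm
      simp [upd, this]

theorem seqOK_append (α β : List (Cmd N C)) (f : Node N → Val C) :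
    SeqOK (α ++ β) f ↔ SeqOK α f ∧ SeqOK β (applySeq α f) := by
  induction α generalizing f with
  | nil => simp [SeqOK, applySeq]
  | cons σ α ih => simp [SeqOK, applySeq, ih, and_assoc]

theorem applySeq_append (α β : List (Cmd N C)) (f : Node N → Val C) :
    applySeq (α ++ β) f = applySeq β (applySeq α f) := by
  induction α generalizing f with
  | nil => simp [applySeq]
  | cons σ α ih => simp [applySeq, ih]

theorem seqOK_valid (α : List (Cmd N C)) (f : Node N → Val C) (hf : ValidFS f)
    (h : SeqOK α f) : ValidFS (applySeq α f) := by
  induction α generalizing f with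
  | nil => exact hf
  | cons σ α ih => exact ih _ h.2.1 h.2.2

theorem seqOK_inp (α : List (Cmd N C)) (f : Node N → Val C) (hnd : α.Nodup)
    (hinj : NodeInj {σ | σ ∈ α}) (h : SeqOK α f) : ∀ σ ∈ α, f σ.node = σ.inp := by
  induction α generalizing f with
  | nil => simp
  | cons σ α ih =>
    have hnd' := List.nodup_cons.1 hnd
    have hinj' : NodeInj {σ | σ ∈ α} := fun a ha b hb =>
      hinj a (List.mem_cons_of_mem _ ha) b (List.mem_cons_of_mem _ hb)
    intro τ hτ
    rcases List.mem_cons.1 hτ with rfl | hτ'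
    · exact h.1
    · have h1 := ih (upd f σ) hnd'.2 hinj' h.2.2 τ hτ'
      have : τ.node ≠ σ.node := by
        intro e
        have : τ = σ := hinj τ hτ σ (by simp) e
        subst this
        exact hnd'.1 hτ'
      simpa [upd, this] using h1

theorem sublist_pair_head {σ τ : Cmd N C} {α : List (Cmd N C)} (hnd : (σ :: α).Nodup)
    (h : List.Sublist [τ, σ] (σ :: α)) : False := by
  have hnd' := List.nodup_cons.1 hnd
  cases h with
  | cons _ h => exact hnd'.1 (h.subset (by simp))
  | cons_cons _ h => exact hnd'.1 (h.subset (by simp))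

theorem key_seq (α : List (Cmd N C)) (f : Node N → Val C) (hnd : α.Nodup)
    (hinj : NodeInj {σ | σ ∈ α}) (hinp : ∀ σ ∈ α, f σ.node = σ.inp)
    (hh : Honors α) (hf : ValidFS f) (hg : ValidFS (applySeq α f)) : SeqOK α f := by
  induction α generalizing f with
  | nil => trivial
  | cons σ α ih =>
    have happ := applySeq_isApp (σ :: α) f hnd hinj
    set g := applySeq (σ :: α) f with hgdef
    have hnd' := List.nodup_cons.1 hnd
    have hinj' : NodeInj {σ | σ ∈ α} := fun a ha b hb =>
      hinj a (List.mem_cons_of_mem _ ha) b (List.mem_cons_of_mem _ hb)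
    have hσ : σ ∈ σ :: α := by simp
    have hgσ : g σ.node = σ.out := happ.1 σ hσ
    have hfσ : f σ.node = σ.inp := hinp σ hσ
    have hv : ValidFS (upd f σ) := by
      apply validFS_of_parent
      · refine (hf.1.insert σ.node).subset ?_
        intro n hn
        by_cases e : n = σ.node
        · exact Or.inl e
        · right
          simpa [upd, e] using hn
      · intro n m hmn hn
        have hanc := anc_of_parent hmn
        have hne : m ≠ n := hanc.2
        by_cases en : n = σ.node
        · have em : m ≠ σ.node := by rw [← en]; exact hne
          subst en
          simp only [upd, if_true] at hn
          simp only [upd, em, if_false]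
          by_contra hfm
          have hgm : g m = Val.dir := hg.2 _ _ hanc (by rw [hgσ]; exact hn)
          obtain ⟨τ, hτ, rfl, hτo⟩ := happ.exists_cmd (n := m) (by rw [hgm]; exact Ne.symm hfm)
          have hfn : f σ.node = Val.empty := by
            by_contra h0
            exact hfm (hf.2 _ _ hanc h0)
          refine sublist_pair_head hnd (hh τ hτ σ hσ (Or.inr ⟨hmn, ?_, ?_, ?_, hn⟩))
          · rw [hτo, hgm]
          · rw [← hinp τ hτ]; exact hfm
          · rw [← hfσ, hfn]
        · simp only [upd, en, if_false] at hn
          have hfm := hf.2 _ _ hanc hn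
          by_cases em : m = σ.node
          · subst em
            simp only [upd, if_true]
            by_contra ho
            have hgn : g n = Val.empty := by
              by_contra h0
              have := hg.2 _ _ hanc h0
              rw [hgσ] at this
              exact ho this
            obtain ⟨τ, hτ, rfl, hτo⟩ := happ.exists_cmd (n := n) (by rw [hgn]; exact Ne.symm hn)
            refine sublist_pair_head hnd (hh τ hτ σ hσ (Or.inl ⟨hmn, ?_, ?_, ?_, ho⟩))
            · rw [hτo, hgn]
            · rw [← hinp τ hτ]; exact hn
            · rw [← hfσ, hfm]
          · simp only [upd, em, if_false]
            exact hfm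
    refine ⟨hfσ, hv, ?_⟩
    · · refine ih (upd f σ) hnd'.2 hinj' ?_ ?_ hv hg
        · intro τ hτ
          have : τ.node ≠ σ.node := by
            intro e
            have : τ = σ := hinj τ (List.mem_cons_of_mem _ hτ) σ (by simp) e
            subst this
            exact hnd'.1 hτ
          simpa [upd, this] using hinp τ (List.mem_cons_of_mem _ hτ)
        · intro a ha b hb hab
          have := hh a (List.mem_cons_of_mem _ ha) b (List.mem_cons_of_mem _ hb) hab
          cases this with
          | cons _ h => exact h
          | cons_cons _ h => exact absurd ha hnd'.1

theorem key_set {S : Set (Cmd N C)} {α : List (Cmd N C)} {f g : Node N → Val C}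
    (ho : Orders S α) (hinj : NodeInj S) (hinp : ∀ σ ∈ S, f σ.node = σ.inp)
    (happ : IsApp S f g) (hf : ValidFS f) (hg : ValidFS g) :
    SeqOK α f ∧ applySeq α f = g := by
  have hS : {σ | σ ∈ α} = S := Set.ext ho.2.1
  have h1 := applySeq_isApp α f ho.1 (hS ▸ hinj)
  rw [hS] at h1
  have e := h1.unique happ
  refine ⟨key_seq α f ho.1 (hS ▸ hinj) (fun σ h => hinp σ ((ho.2.1 σ).1 h)) ho.2.2 hf (e ▸ hg), e⟩

end seqs

/-! Existence of arrangements -/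

open Classical in
/-- rank function increasing along `LL` -/
noncomputable def rk (σ : Cmd N C) : ℤ :=
  if σ.inp = Val.dir ∨ σ.out = Val.empty then -(σ.node.1.length : ℤ) else σ.node.1.length

theorem rk_lt {σ τ : Cmd N C} (h : LL σ τ) : rk σ < rk τ := by
  rcases h with ⟨hp, h1, h2, h3, h4⟩ | ⟨hp, h1, h2, h3, h4⟩
  · have := hp.length_eq
    simp only [rk, h1, h3, or_true, true_or, if_true]
    omega
  · have := hp.length_eq
    simp [rk, h1, h2, h3, h4]
    omega

theorem exists_orders {S : Set (Cmd N C)} (hS : S.Finite) : ∃ α, Orders S α := by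
  classical
  let r : Cmd N C → Cmd N C → Prop := fun a b => rk a ≤ rk b
  haveI : Std.Total r := ⟨fun a b => le_total _ _⟩
  haveI : IsTrans (Cmd N C) r := ⟨fun a b c => le_trans⟩
  refine ⟨hS.toFinset.toList.insertionSort r, ?_, ?_, ?_⟩
  · exact (List.perm_insertionSort r _).nodup_iff.2 (Finset.nodup_toList _)
  · intro σ
    rw [(List.perm_insertionSort r _).mem_iff]
    simp
  · have hs := List.pairwise_insertionSort r hS.toFinset.toList
    generalize hS.toFinset.toList.insertionSort r = l at hs
    intro σ hσ τ hτ h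
    have hlt := rk_lt h
    clear h
    induction l with
    | nil => simp at hσ
    | cons a l ih =>
      have hs' := List.pairwise_cons.1 hs
      rcases List.mem_cons.1 hσ with rfl | hσ'
      · rcases List.mem_cons.1 hτ with rfl | hτ
        · omega
        · exact List.Sublist.cons_cons _ (List.singleton_sublist.2 hτ)
      · rcases List.mem_cons.1 hτ with rfl | hτ
        · have : rk τ ≤ rk σ := hs'.1 σ hσ'
          omega
        · exact List.Sublist.cons _ (ih hs'.2 hσ' hτ)

theorem initSeg_of_down {A B : Set (Cmd N C)} (hA : A.Finite) (hB : B ⊆ A)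
    (hd : ∀ σ ∈ A, ∀ τ ∈ B, LL σ τ → σ ∈ B) : InitSeg B A := by
  obtain ⟨α, hα⟩ := exists_orders (hA.subset hB)
  obtain ⟨β, hβ⟩ := exists_orders (hA.subset (Set.diff_subset (s := A) (t := B)))
  refine ⟨hB, α, β, hα, hβ, ?_, ?_, ?_⟩
  · refine List.nodup_append.2 ⟨hα.1, hβ.1, ?_⟩
    rintro a ha b hb rfl
    exact ((hβ.2.1 a).1 hb).2 ((hα.2.1 a).1 ha)
  · intro σ
    rw [List.mem_append, hα.2.1, hβ.2.1]
    constructor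
    · rintro (h | h)
      · exact hB h
      · exact h.1
    · intro h
      by_cases hb : σ ∈ B
      · exact Or.inl hb
      · exact Or.inr ⟨h, hb⟩
  · intro σ hσ τ hτ h
    rcases List.mem_append.1 hσ with hσ | hσ <;> rcases List.mem_append.1 hτ with hτ | hτ
    · exact (hα.2.2 σ hσ τ hτ h).trans (List.sublist_append_left _ _)
    · exact List.Sublist.append (List.singleton_sublist.2 hσ) (List.singleton_sublist.2 hτ)
    · have h1 := (hβ.2.1 σ).1 hσ
      exact absurd (hd σ h1.1 τ ((hα.2.1 τ).1 hτ) h) h1.2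
    · exact (hβ.2.2 σ hσ τ hτ h).trans (List.sublist_append_right _ _)

/-! Characterisation of connectedness -/

/-- every node strictly between carries the command from `x` to `y` -/
def Between (S : Set (Cmd N C)) (x y : Val C) (m n : Node N) : Prop :=
  ∀ q, Anc m q → Anc q n → ∃ ρ ∈ S, ρ.node = q ∧ ρ.inp = x ∧ ρ.out = y

def DownC (S : Set (Cmd N C)) (σ τ : Cmd N C) : Prop :=
  σ.out = Val.dir ∧ σ.inp ≠ Val.dir ∧ τ.inp = Val.empty ∧ τ.out ≠ Val.empty ∧
    Between S Val.empty Val.dir σ.node τ.node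

def UpC (S : Set (Cmd N C)) (σ τ : Cmd N C) : Prop :=
  σ.inp = Val.dir ∧ σ.out ≠ Val.dir ∧ τ.out = Val.empty ∧ τ.inp ≠ Val.empty ∧
    Between S Val.dir Val.empty σ.node τ.node

theorem between_parent {S : Set (Cmd N C)} {x y : Val C} {m n : Node N} (h : IsParent m n) :
    Between S x y m n := by
  intro q h1 h2
  have := h1.length_lt
  have := h2.length_lt
  have := h.length_eq
  omega

theorem chain_char {S : Set (Cmd N C)} {σ τ : Cmd N C}
    (h : Relation.ReflTransGen (fun a b => a ∈ S ∧ b ∈ S ∧ LL a b) σ τ) :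
    σ = τ ∨ (Anc σ.node τ.node ∧ DownC S σ τ) ∨ (Anc τ.node σ.node ∧ UpC S τ σ) := by
  induction h with
  | refl => exact Or.inl rfl
  | @tail b c _ hbc ih =>
    obtain ⟨hb, hc, hl⟩ := hbc
    rcases ih with rfl | ⟨ha, d1, d2, d3, d4, d5⟩ | ⟨ha, d1, d2, d3, d4, d5⟩
    · rcases hl with ⟨hp, h1, h2, h3, h4⟩ | ⟨hp, h1, h2, h3, h4⟩
      · exact Or.inr (Or.inr ⟨anc_of_parent hp, h3, h4, h1, h2, between_parent hp⟩)
      · exact Or.inr (Or.inl ⟨anc_of_parent hp, h1, h2, h3, h4, between_parent hp⟩)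
    · rcases hl with ⟨hp, h1, h2, h3, h4⟩ | ⟨hp, h1, h2, h3, h4⟩
      · exact absurd h1 d4
      · refine Or.inr (Or.inl ⟨ha.trans' (anc_of_parent hp), d1, d2, h3, h4, ?_⟩)
        intro q q1 q2
        rcases anc_parent q2 hp with rfl | q3
        · exact ⟨b, hb, rfl, d3, h1⟩
        · exact d5 q q1 q3
    · rcases hl with ⟨hp, h1, h2, h3, h4⟩ | ⟨hp, h1, h2, h3, h4⟩
      · refine Or.inr (Or.inr ⟨(anc_of_parent hp).trans' ha, h3, h4, d3, d4, ?_⟩)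
        intro q q1 q2
        rcases anc_total q2 ha with rfl | q3 | q3
        · exact ⟨b, hb, rfl, d1, h1⟩
        · have := q3.length_lt
          have := q1.length_lt
          have := hp.length_eq
          omega
        · exact d5 q q3 q2
      · exact absurd h1 d2

theorem chain_down {S : Set (Cmd N C)} {σ τ : Cmd N C} (hσ : σ ∈ S) (hτ : τ ∈ S)
    (ha : Anc σ.node τ.node) (h : DownC S σ τ) :
    Relation.ReflTransGen (fun a b => a ∈ S ∧ b ∈ S ∧ LL a b) σ τ := by
  induction hk : τ.node.1.length generalizing τ with
  | zero => exact absurd (List.length_eq_zero_iff.1 hk) τ.node.2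
  | succ k ih =>
    obtain ⟨p, hp⟩ := exists_parent ha
    obtain ⟨d1, d2, d3, d4, d5⟩ := h
    rcases anc_parent ha hp with rfl | hq
    · exact Relation.ReflTransGen.single ⟨hσ, hτ, Or.inr ⟨hp, d1, d2, d3, d4⟩⟩
    · obtain ⟨ρ, hρ, rfl, hi, ho⟩ := d5 p hq (anc_of_parent hp)
      refine Relation.ReflTransGen.tail
        (ih hρ hq ⟨d1, d2, hi, by simp [ho], ?_⟩ (by have := hp.length_eq; omega))
        ⟨hρ, hτ, Or.inr ⟨hp, ho, by simp [hi], d3, d4⟩⟩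
      intro q q1 q2
      exact d5 q q1 (q2.trans' (anc_of_parent hp))

theorem chain_up {S : Set (Cmd N C)} {σ τ : Cmd N C} (hσ : σ ∈ S) (hτ : τ ∈ S)
    (ha : Anc σ.node τ.node) (h : UpC S σ τ) :
    Relation.ReflTransGen (fun a b => a ∈ S ∧ b ∈ S ∧ LL a b) τ σ := by
  induction hk : τ.node.1.length generalizing τ with
  | zero => exact absurd (List.length_eq_zero_iff.1 hk) τ.node.2
  | succ k ih =>
    obtain ⟨p, hp⟩ := exists_parent ha
    obtain ⟨d1, d2, d3, d4, d5⟩ := h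
    rcases anc_parent ha hp with rfl | hq
    · exact Relation.ReflTransGen.single ⟨hτ, hσ, Or.inl ⟨hp, d3, d4, d1, d2⟩⟩
    · obtain ⟨ρ, hρ, rfl, hi, ho⟩ := d5 p hq (anc_of_parent hp)
      refine Relation.ReflTransGen.head
        ⟨hτ, hρ, Or.inl ⟨hp, d3, d4, hi, by simp [ho]⟩⟩
        (ih hρ hq ⟨d1, d2, ho, by simp [hi], ?_⟩ (by have := hp.length_eq; omega))
      intro q q1 q2
      exact d5 q q1 (q2.trans' (anc_of_parent hp))

theorem canonical_char {S : Set (Cmd N C)} (hS : Canonical S) {σ τ : Cmd N C}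
    (hσ : σ ∈ S) (hτ : τ ∈ S) (ha : Anc σ.node τ.node) : DownC S σ τ ∨ UpC S σ τ := by
  rcases hS.2.2.2 σ hσ τ hτ ha.2 (Or.inl ha.1) with h | h
  · rcases chain_char h with rfl | ⟨_, h⟩ | ⟨h, _⟩
    · exact absurd rfl ha.2
    · exact Or.inl h
    · exact (ha.asymm' h).elim
  · rcases chain_char h with rfl | ⟨h, _⟩ | ⟨_, h⟩
    · exact absurd rfl ha.2
    · exact (ha.asymm' h).elim
    · exact Or.inr h

theorem canonical_of_char {S : Set (Cmd N C)} (hfin : S.Finite)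
    (hnn : ∀ σ ∈ S, σ.inp ≠ σ.out) (hinj : NodeInj S)
    (h : ∀ σ ∈ S, ∀ τ ∈ S, Anc σ.node τ.node → DownC S σ τ ∨ UpC S σ τ) : Canonical S := by
  have key : ∀ σ ∈ S, ∀ τ ∈ S, Anc σ.node τ.node →
      Relation.ReflTransGen (fun a b => a ∈ S ∧ b ∈ S ∧ LL a b) σ τ ∨
      Relation.ReflTransGen (fun a b => a ∈ S ∧ b ∈ S ∧ LL a b) τ σ := by
    intro σ hσ τ hτ ha
    rcases h σ hσ τ hτ ha with h | h
    · exact Or.inl (chain_down hσ hτ ha h)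
    · exact Or.inr (chain_up hσ hτ ha h)
  refine ⟨hfin, hnn, hinj, ?_⟩
  intro σ hσ τ hτ hne hcmp
  rcases hcmp with hc | hc
  · exact key σ hσ τ hτ ⟨hc, hne⟩
  · exact (key τ hτ σ hσ ⟨hc, Ne.symm hne⟩).symm

theorem Between.mono {S T : Set (Cmd N C)} (hST : S ⊆ T) {x y : Val C} {m n : Node N}
    (h : Between S x y m n) : Between T x y m n := by
  intro q h1 h2
  obtain ⟨ρ, hρ, h⟩ := h q h1 h2
  exact ⟨ρ, hST hρ, h⟩

theorem char_mono {S T : Set (Cmd N C)} (hST : S ⊆ T) {σ τ : Cmd N C}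
    (h : DownC S σ τ ∨ UpC S σ τ) : DownC T σ τ ∨ UpC T σ τ := by
  rcases h with ⟨d1, d2, d3, d4, d5⟩ | ⟨d1, d2, d3, d4, d5⟩
  · exact Or.inl ⟨d1, d2, d3, d4, d5.mono hST⟩
  · exact Or.inr ⟨d1, d2, d3, d4, d5.mono hST⟩

theorem cmd_ext {σ τ : Cmd N C} (h1 : σ.node = τ.node) (h2 : σ.inp = τ.inp)
    (h3 : σ.out = τ.out) : σ = τ := by
  cases σ; cases τ; simp_all

/-- commands creating the directories above newly created content -/
def newDirs (f : Node N → Val C) (M : Set (Cmd N C)) : Set (Cmd N C) :=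
  {ρ | f ρ.node = ρ.inp ∧ ρ.out = Val.dir ∧ f ρ.node ≠ Val.dir ∧
    ∃ σ ∈ M, Anc ρ.node σ.node ∧ σ.out ≠ Val.empty}

/-- commands erasing content below a destroyed directory -/
def newDels (f : Node N → Val C) (M : Set (Cmd N C)) : Set (Cmd N C) :=
  {ρ | f ρ.node = ρ.inp ∧ ρ.out = Val.empty ∧ f ρ.node ≠ Val.empty ∧
    ∃ σ ∈ M, Anc σ.node ρ.node ∧ σ.out ≠ Val.dir}

theorem canonical_newDirs {f : Node N → Val C} (hf : ValidFS f) {M : Set (Cmd N C)}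
    (hM : Canonical M) (hinp : ∀ σ ∈ M, f σ.node = σ.inp) (hfin : (M ∪ newDirs f M).Finite) :
    Canonical (M ∪ newDirs f M) := by
  have huniq : ∀ ρ ∈ M, ∀ ρ' ∈ newDirs f M, ρ.node = ρ'.node → ρ = ρ' := by
    rintro ρ hρ ρ' ⟨h1, h2, h3, σ, hσ, h4, h5⟩ e
    rcases canonical_char hM hρ hσ (e ▸ h4) with d | d
    · exact cmd_ext e (by rw [← hinp ρ hρ, e, h1]) (by rw [d.1, h2])
    · exact absurd d.2.2.1 h5
  have hE : ∀ m n : Node N, f m ≠ Val.dir → Anc m n → f n = Val.empty := by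
    intro m n hm ha
    by_contra h0
    exact hm (hf.2 _ _ ha h0)
  have hbet : ∀ m n : Node N, f m ≠ Val.dir → (∃ σ ∈ M, n.1 <+: σ.node.1 ∧ σ.out ≠ Val.empty) →
      Between (M ∪ newDirs f M) Val.empty Val.dir m n := by
    rintro m n hm ⟨σ, hσ, h1, h2⟩ q hq hqn
    have hfq := hE m q hm hq
    exact ⟨⟨q, Val.empty, Val.dir⟩, Or.inr ⟨hfq, rfl, by simp [hfq], σ, hσ,
      Anc.of_pre (hqn.1.trans h1) (hqn.length_lt.trans_le h1.length_le), h2⟩, rfl, rfl, rfl⟩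
  refine canonical_of_char hfin ?_ ?_ ?_
  · rintro σ (h | h)
    · exact hM.2.1 σ h
    · rw [← h.1, h.2.1]; exact h.2.2.1
  · rintro σ (hσ | hσ) τ (hτ | hτ) e
    · exact hM.2.2.1 σ hσ τ hτ e
    · exact huniq σ hσ τ hτ e
    · exact (huniq τ hτ σ hσ e.symm).symm
    · exact cmd_ext e (by rw [← hσ.1, ← hτ.1, e]) (by rw [hσ.2.1, hτ.2.1])
  · rintro σ (hσ | hσ) τ (hτ | hτ) ha
    · exact char_mono Set.subset_union_left (canonical_char hM hσ hτ ha)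
    · obtain ⟨h1, h2, h3, ρ, hρ, h4, h5⟩ := hτ
      have : τ ∈ M := by
        rcases canonical_char hM hσ hρ (ha.trans' h4) with d | d
        · obtain ⟨κ, hκ, e, -, -⟩ := d.2.2.2.2 τ.node ha h4
          have := huniq κ hκ τ ⟨h1, h2, h3, ρ, hρ, h4, h5⟩ e
          exact this ▸ hκ
        · exact absurd d.2.2.1 h5
      exact char_mono Set.subset_union_left (canonical_char hM hσ this ha)
    · obtain ⟨h1, h2, h3, -⟩ := hσ
      have hτe := hE _ _ h3 ha
      have hτi : τ.inp = Val.empty := by rw [← hinp τ hτ, hτe]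
      have hτo : τ.out ≠ Val.empty := by
        have := hM.2.1 τ hτ
        rw [hτi] at this
        exact this.symm
      exact Or.inl ⟨h2, h1 ▸ h3, hτi, hτo, hbet _ _ h3 ⟨τ, hτ, List.prefix_rfl, hτo⟩⟩
    · obtain ⟨h1, h2, h3, -⟩ := hσ
      obtain ⟨k1, k2, k3, ρ, hρ, k4, k5⟩ := hτ
      have hτe := hE _ _ h3 ha
      exact Or.inl ⟨h2, h1 ▸ h3, by rw [← k1, hτe], by simp [k2],
        hbet _ _ h3 ⟨ρ, hρ, k4.1, k5⟩⟩

theorem canonical_newDels {f : Node N → Val C} (hf : ValidFS f) {M : Set (Cmd N C)}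
    (hM : Canonical M) (hinp : ∀ σ ∈ M, f σ.node = σ.inp) (hfin : (M ∪ newDels f M).Finite) :
    Canonical (M ∪ newDels f M) := by
  have huniq : ∀ ρ ∈ M, ∀ ρ' ∈ newDels f M, ρ.node = ρ'.node → ρ = ρ' := by
    rintro ρ hρ ρ' ⟨h1, h2, h3, σ, hσ, h4, h5⟩ e
    rcases canonical_char hM hσ hρ (e ▸ h4) with d | d
    · exact absurd d.1 h5
    · exact cmd_ext e (by rw [← hinp ρ hρ, e, h1]) (by rw [d.2.2.1, h2])
  have hbet : ∀ m n : Node N, f n ≠ Val.empty → (∃ σ ∈ M, σ.node.1 <+: m.1 ∧ σ.out ≠ Val.dir) →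
      Between (M ∪ newDels f M) Val.dir Val.empty m n := by
    rintro m n hn ⟨σ, hσ, h1, h2⟩ q hq hqn
    have hfq := hf.2 _ _ hqn hn
    exact ⟨⟨q, Val.dir, Val.empty⟩, Or.inr ⟨hfq, rfl, by simp [hfq], σ, hσ,
      Anc.of_pre (h1.trans hq.1) (h1.length_le.trans_lt hq.length_lt), h2⟩, rfl, rfl, rfl⟩
  refine canonical_of_char hfin ?_ ?_ ?_
  · rintro σ (h | h)
    · exact hM.2.1 σ h
    · rw [← h.1, h.2.1]; exact h.2.2.1
  · rintro σ (hσ | hσ) τ (hτ | hτ) e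
    · exact hM.2.2.1 σ hσ τ hτ e
    · exact huniq σ hσ τ hτ e
    · exact (huniq τ hτ σ hσ e.symm).symm
    · exact cmd_ext e (by rw [← hσ.1, ← hτ.1, e]) (by rw [hσ.2.1, hτ.2.1])
  · rintro σ (hσ | hσ) τ (hτ | hτ) ha
    · exact char_mono Set.subset_union_left (canonical_char hM hσ hτ ha)
    · -- only the input of `τ` matters: the command above it is a destroyed directory
      have h3 := hτ.2.2.1
      have hσd := hf.2 _ _ ha h3
      have hσi : σ.inp = Val.dir := by rw [← hinp σ hσ, hσd]
      have hσo : σ.out ≠ Val.dir := by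
        have := hM.2.1 σ hσ
        rw [hσi] at this
        exact this.symm
      exact Or.inr ⟨hσi, hσo, hτ.2.1, hτ.1 ▸ h3, hbet _ _ h3 ⟨σ, hσ, List.prefix_rfl, hσo⟩⟩
    · obtain ⟨h1, h2, h3, ρ, hρ, h4, h5⟩ := hσ
      have : σ ∈ M := by
        rcases canonical_char hM hρ hτ (h4.trans' ha) with d | d
        · exact absurd d.1 h5
        · obtain ⟨κ, hκ, e, -, -⟩ := d.2.2.2.2 σ.node h4 ha
          have := huniq κ hκ σ ⟨h1, h2, h3, ρ, hρ, h4, h5⟩ e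
          exact this ▸ hκ
      exact char_mono Set.subset_union_left (canonical_char hM this hτ ha)
    · obtain ⟨h1, h2, h3, ρ, hρ, h4, h5⟩ := hσ
      have k3 := hτ.2.2.1
      have hσd := hf.2 _ _ ha k3
      exact Or.inr ⟨by rw [← h1, hσd], by simp [h2], hτ.2.1, hτ.1 ▸ k3,
        hbet _ _ k3 ⟨ρ, hρ, h4.1, h5⟩⟩

/-- a command of `S` is the only possible one at its node when the result differs -/
theorem IsApp.mem_of {S : Set (Cmd N C)} {f g : Node N → Val C} (h : IsApp S f g)
    (hinp : ∀ σ ∈ S, f σ.node = σ.inp) {ρ : Cmd N C} (h1 : f ρ.node = ρ.inp)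
    (h2 : g ρ.node = ρ.out) (h3 : ρ.inp ≠ ρ.out) : ρ ∈ S := by
  obtain ⟨σ, hσ, e, ho⟩ := h.exists_cmd (n := ρ.node) (by rw [h1, h2]; exact h3.symm)
  have : σ = ρ := cmd_ext e (by rw [← hinp σ hσ, e, h1]) (by rw [ho, h2])
  exact this ▸ hσ

theorem merger_valid {k : ℕ} {A : Fin k → Set (Cmd N C)} {M : Set (Cmd N C)}
    (hM : Merger A M) (hfinA : ∀ i, (A i).Finite) {f : Node N → Val C} (hf : ValidFS f)
    (hinp : ∀ i, ∀ σ ∈ A i, f σ.node = σ.inp) {H : Fin k → Node N → Val C}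
    (hH : ∀ i, IsApp (A i) f (H i)) (hHv : ∀ i, ValidFS (H i)) {g : Node N → Val C}
    (hg : IsApp M f g) : ValidFS g := by
  obtain ⟨hMU, hMc, hmax⟩ := hM
  have hinpM : ∀ σ ∈ M, f σ.node = σ.inp := by
    intro σ hσ
    obtain ⟨i, hi⟩ := Set.mem_iUnion.1 (hMU hσ)
    exact hinp i σ hi
  have hUfin : (⋃ i, A i).Finite := Set.finite_iUnion hfinA
  have s1 : M ∪ newDirs f M ⊆ ⋃ i, A i := by
    refine Set.union_subset hMU ?_
    rintro ρ ⟨h1, h2, h3, σ, hσ, h4, h5⟩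
    obtain ⟨i, hi⟩ := Set.mem_iUnion.1 (hMU hσ)
    refine Set.mem_iUnion.2 ⟨i, (hH i).mem_of (hinp i) h1 ?_ ?_⟩
    · rw [h2]
      exact (hHv i).2 _ _ h4 (by rw [(hH i).1 σ hi]; exact h5)
    · rw [h2, ← h1]; exact h3
  have s2 : M ∪ newDels f M ⊆ ⋃ i, A i := by
    refine Set.union_subset hMU ?_
    rintro ρ ⟨h1, h2, h3, σ, hσ, h4, h5⟩
    obtain ⟨i, hi⟩ := Set.mem_iUnion.1 (hMU hσ)
    refine Set.mem_iUnion.2 ⟨i, (hH i).mem_of (hinp i) h1 ?_ ?_⟩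
    · rw [h2]
      by_contra h0
      have := (hHv i).2 _ _ h4 h0
      rw [(hH i).1 σ hi] at this
      exact h5 this
    · rw [h2, ← h1]; exact h3
  have e1 := hmax _ Set.subset_union_left s1
    (canonical_newDirs hf hMc hinpM (hUfin.subset s1))
  have e2 := hmax _ Set.subset_union_left s2
    (canonical_newDels hf hMc hinpM (hUfin.subset s2))
  have n1 : newDirs f M ⊆ M := Set.union_eq_left.1 e1
  have n2 : newDels f M ⊆ M := Set.union_eq_left.1 e2
  refine ⟨hg.finite hMc.1 hf, ?_⟩
  intro n m hmn hn
  by_cases hmem : ∃ σ ∈ M, σ.node = n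
  · obtain ⟨σ, hσ, rfl⟩ := hmem
    rw [hg.1 σ hσ] at hn
    by_cases hfm : f m = Val.dir
    · rw [hg.2 m, hfm]
      rintro τ hτ rfl
      rcases canonical_char hMc hτ hσ hmn with d | d
      · exact d.2.1 (by rw [← hinpM τ hτ, hfm])
      · exact hn d.2.2.1
    · have : (⟨m, f m, Val.dir⟩ : Cmd N C) ∈ M := n1 ⟨rfl, rfl, hfm, σ, hσ, hmn, hn⟩
      exact hg.1 _ this
  · have hmem' : ∀ σ ∈ M, σ.node ≠ n := by push Not at hmem; exact hmem
    rw [hg.2 n hmem'] at hn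
    have hfm := hf.2 _ _ hmn hn
    rw [hg.2 m, hfm]
    rintro τ hτ rfl
    have hτo : τ.out ≠ Val.dir := by
      have := hMc.2.1 τ hτ
      rw [← hinpM τ hτ, hfm] at this
      exact this.symm
    exact hmem' ⟨n, f n, Val.empty⟩ (n2 ⟨rfl, rfl, hn, τ, hτ, hmn, hτo⟩) rfl

/-- the common part of two non-breaking sets does not break -/
theorem inter_valid {A M : Set (Cmd N C)} {f h g p : Node N → Val C} (hfin : M.Finite)
    (hf : ValidFS f) (hh : ValidFS h) (hg : ValidFS g)
    (hA : IsApp A f h) (hM : IsApp M f g) (hp : IsApp (M ∩ A) f p)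
    (iA : ∀ σ ∈ A, f σ.node = σ.inp) (iM : ∀ σ ∈ M, f σ.node = σ.inp) : ValidFS p := by
  have common : ∀ n v, f n ≠ v → h n = v → g n = v → p n = v := by
    intro n v h1 h2 h3
    have a : (⟨n, f n, v⟩ : Cmd N C) ∈ A := hA.mem_of iA rfl h2 h1
    have b : (⟨n, f n, v⟩ : Cmd N C) ∈ M := hM.mem_of iM rfl h3 h1
    exact hp.1 _ ⟨b, a⟩
  refine ⟨hp.finite (hfin.subset Set.inter_subset_left) hf, ?_⟩
  intro n m hmn hn
  by_cases e : p n = f n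
  · have hfn : f n ≠ Val.empty := e ▸ hn
    have hfm := hf.2 _ _ hmn hfn
    by_contra hpm
    obtain ⟨σ, ⟨hσM, hσA⟩, rfl, ho⟩ := hp.exists_cmd (n := m) (by rw [hfm]; exact hpm)
    apply hn
    apply common n _ hfn
    · by_contra h0
      have := hh.2 _ _ hmn h0
      rw [hA.1 σ hσA, ho] at this
      exact hpm this
    · by_contra h0
      have := hg.2 _ _ hmn h0
      rw [hM.1 σ hσM, ho] at this
      exact hpm this
  · obtain ⟨σ, ⟨hσM, hσA⟩, rfl, ho⟩ := hp.exists_cmd e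
    have h1 : h m = Val.dir := hh.2 _ _ hmn (by rw [hA.1 σ hσA, ho]; exact hn)
    have h2 : g m = Val.dir := hg.2 _ _ hmn (by rw [hM.1 σ hσM, ho]; exact hn)
    by_cases hfm : f m = Val.dir
    · by_contra hpm
      obtain ⟨τ, ⟨hτM, hτA⟩, rfl, ho'⟩ := hp.exists_cmd (n := m) (by rw [hfm]; exact hpm)
      rw [hA.1 τ hτA, ho'] at h1
      exact hpm h1
    · exact common m _ hfm h1 h2

/-- a non-breaking set contains the `LL`-predecessors of its commands -/
theorem mem_of_LL {M : Set (Cmd N C)} {f g : Node N → Val C} (hf : ValidFS f) (hg : ValidFS g)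
    (hM : IsApp M f g) (iM : ∀ σ ∈ M, f σ.node = σ.inp) {σ τ : Cmd N C} (hτ : τ ∈ M)
    (hσ : f σ.node = σ.inp) (h : LL σ τ) : σ ∈ M := by
  rcases h with ⟨hp, h1, h2, h3, h4⟩ | ⟨hp, h1, h2, h3, h4⟩
  · refine hM.mem_of iM hσ ?_ (by rw [h1]; exact h2)
    rw [h1]
    by_contra h0
    have := hg.2 _ _ (anc_of_parent hp) h0
    rw [hM.1 τ hτ] at this
    exact h4 this
  · refine hM.mem_of iM hσ ?_ (by rw [h1]; exact h2)
    rw [h1]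
    exact hg.2 _ _ (anc_of_parent hp) (by rw [hM.1 τ hτ]; exact h4)

/-- For a merger `M` of jointly refluent canonical sets `A i` and a
filesystem `FS` none of the `A i` breaks: `M ∩ A i` is an initial segment of both `A i`
and `M`, and applying first `(A i \ M)⁻¹` and then `M \ A i` to `A i FS` yields `M FS`. -/
theorem stmt_15 {N C : Type} [DecidableEq N] {k : ℕ} (A : Fin k → Set (Cmd N C))
    (hc : ∀ i, Canonical (A i)) (M : Set (Cmd N C)) (hM : Merger A M)
    (f : Node N → Val C) (hf : ValidFS f) (h : ∀ i, SetNoBreak (A i) f) :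
    ∀ i, InitSeg (M ∩ A i) (A i) ∧ InitSeg (M ∩ A i) M ∧
      ∀ α γ δ μ : List (Cmd N C),
        Orders (A i) α → Orders (cinv '' (A i \ M)) γ → Orders (M \ A i) δ →
        Orders M μ →
        SeqOK (α ++ γ ++ δ) f ∧ SeqOK μ f ∧
        applySeq (α ++ γ ++ δ) f = applySeq μ f := by
  have hinjA : ∀ i, NodeInj (A i) := fun i => (hc i).2.2.1
  have data : ∀ i, ∃ H, IsApp (A i) f H ∧ ValidFS H ∧ ∀ σ ∈ A i, f σ.node = σ.inp := by
    intro i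
    obtain ⟨⟨α, hα⟩, hall⟩ := h i
    have hS : {σ | σ ∈ α} = A i := Set.ext hα.2.1
    have h1 := applySeq_isApp α f hα.1 (hS ▸ hinjA i)
    have h2 := seqOK_inp α f hα.1 (hS ▸ hinjA i) (hall α hα)
    rw [hS] at h1
    exact ⟨_, h1, seqOK_valid α f hf (hall α hα), fun σ hσ => h2 σ ((hα.2.1 σ).2 hσ)⟩
  choose H hH hHv hinp using data
  have hMc := hM.2.1
  have hinjM : NodeInj M := hMc.2.2.1
  have hinpM : ∀ σ ∈ M, f σ.node = σ.inp := by
    intro σ hσ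
    obtain ⟨i, hi⟩ := Set.mem_iUnion.1 (hM.1 hσ)
    exact hinp i σ hi
  obtain ⟨g, hg⟩ := exists_isApp hinjM f
  have hgv : ValidFS g := merger_valid hM (fun i => (hc i).1) hf hinp hH hHv hg
  intro i
  have hinjI : NodeInj (M ∩ A i) := fun σ hσ τ hτ => hinjM σ hσ.1 τ hτ.1
  obtain ⟨p, hp⟩ := exists_isApp hinjI f
  have hpv : ValidFS p := inter_valid hMc.1 hf (hHv i) hgv (hH i) hg hp (hinp i) hinpM
  refine ⟨?_, ?_, ?_⟩
  · refine initSeg_of_down (hc i).1 Set.inter_subset_right ?_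
    intro σ hσ τ hτ hl
    exact ⟨mem_of_LL hf hgv hg hinpM hτ.1 (hinp i σ hσ) hl, hσ⟩
  · refine initSeg_of_down hMc.1 Set.inter_subset_left ?_
    intro σ hσ τ hτ hl
    exact ⟨hσ, mem_of_LL hf (hHv i) (hH i) (hinp i) hτ.2 (hinpM σ hσ) hl⟩
  · intro α γ δ μ hα hγ hδ hμ
    obtain ⟨a1, a2⟩ := key_set hα (hinjA i) (hinp i) (hH i) hf (hHv i)
    obtain ⟨m1, m2⟩ := key_set hμ hinjM hinpM hg hf hgv
    have c1 : NodeInj (cinv '' (A i \ M)) := by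
      rintro _ ⟨σ, hσ, rfl⟩ _ ⟨τ, hτ, rfl⟩ e
      rw [hinjA i σ hσ.1 τ hτ.1 e]
    have pA : ∀ σ ∈ A i \ M, p σ.node = f σ.node := by
      intro σ hσ
      apply hp.2
      intro τ hτ e
      have := hinjA i τ hτ.2 σ hσ.1 e
      exact hσ.2 (this ▸ hτ.1)
    have pM : ∀ σ ∈ M \ A i, p σ.node = f σ.node := by
      intro σ hσ
      apply hp.2
      intro τ hτ e
      have := hinjM τ hτ.1 σ hσ.1 e
      exact hσ.2 (this ▸ hτ.2)
    have c2 : IsApp (cinv '' (A i \ M)) (H i) p := by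
      refine ⟨?_, ?_⟩
      · rintro _ ⟨σ, hσ, rfl⟩
        exact (pA σ hσ).trans (hinp i σ hσ.1)
      · intro n hn
        by_cases hm : ∃ σ ∈ A i, σ.node = n
        · obtain ⟨σ, hσ, rfl⟩ := hm
          have hσM : σ ∈ M := by
            by_contra h0
            exact hn (cinv σ) ⟨σ, ⟨hσ, h0⟩, rfl⟩ rfl
          rw [hp.1 σ ⟨hσM, hσ⟩, (hH i).1 σ hσ]
        · push Not at hm
          rw [(hH i).2 n hm, hp.2 n (fun σ hσ => hm σ hσ.2)]
    have c3 : ∀ σ ∈ cinv '' (A i \ M), H i σ.node = σ.inp := by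
      rintro _ ⟨σ, hσ, rfl⟩
      exact (hH i).1 σ hσ.1
    obtain ⟨g1, g2⟩ := key_set hγ c1 c3 c2 (hHv i) hpv
    have d1 : NodeInj (M \ A i) := fun σ hσ τ hτ => hinjM σ hσ.1 τ hτ.1
    have d2 : IsApp (M \ A i) p g := by
      refine ⟨fun σ hσ => hg.1 σ hσ.1, ?_⟩
      intro n hn
      by_cases hm : ∃ σ ∈ M, σ.node = n
      · obtain ⟨σ, hσ, rfl⟩ := hm
        have hσA : σ ∈ A i := by
          by_contra h0
          exact hn σ ⟨hσ, h0⟩ rfl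
        rw [hp.1 σ ⟨hσ, hσA⟩, hg.1 σ hσ]
      · push Not at hm
        rw [hg.2 n hm, hp.2 n (fun σ hσ => hm σ hσ.1)]
    have d3 : ∀ σ ∈ M \ A i, p σ.node = σ.inp := fun σ hσ => (pM σ hσ).trans (hinpM σ hσ.1)
    obtain ⟨e1, e2⟩ := key_set hδ d1 d3 d2 hpv hgv
    refine ⟨?_, m1, ?_⟩
    · rw [seqOK_append, seqOK_append, applySeq_append, a2, g2]
      exact ⟨⟨a1, g1⟩, e1⟩
    · rw [applySeq_append, applySeq_append, a2, g2, e2, m2]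

end FileSync
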